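/- Let T be an infinite binary tree domain, let K ≥ 1 be a natural number, and let D be a K-sparse distribution on T. Then there exists a flow f on T that is compatible with D, bounded by 7K, satisfies f(ε) = 0, and moreover satisfies f(x) ≥ 0 for every node x ∈ T that lies on an infinite branch of T (i.e. such that infinitely many nodes of T have x as a prefix). -/

import Mathlib

/-- Nodes of the infinite binary tree: finite words over {0,1}. -/
abbrev Node : Type := List Bool

/-- A binary tree domain: a nonempty, prefix-closed, purely binary set of nodes. -/
def IsTreeDomain (T : Set Node) : Prop :=
  T.Nonempty ∧ (∀ u v : Node, u <+: v → v ∈ T → u ∈ T) ∧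
  ∀ u : Node, (u ++ [false] ∈ T ↔ u ++ [true] ∈ T)

/-- `x` is the least element of `Z` for the prefix ordering. -/
def ZoneLeast (Z : Set Node) (x : Node) : Prop := x ∈ Z ∧ ∀ z ∈ Z, x <+: z

/-- A zone of `T`: a subset of `T` with a least element for the prefix order,
convex for the prefix order. -/
def IsZone (T Z : Set Node) : Prop :=
  Z ⊆ T ∧ (∃ x, ZoneLeast Z x) ∧
  ∀ a y z : Node, a ∈ Z → z ∈ Z → a <+: y → y <+: z → y ∈ Z

/-- The frontier of a zone `Z` of `T`: its least element together with all nodes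
of `T \ Z` whose parent belongs to `Z`. -/
def zoneFrontier (T Z : Set Node) : Set Node :=
  {x | ZoneLeast Z x} ∪ {y | y ∈ T ∧ y ∉ Z ∧ y ≠ [] ∧ y.dropLast ∈ Z}

/-- The weight `D(Z)` of a finite zone `Z` under a distribution `D`. -/
def ZoneSum (D : Node → ℕ) (Z : Finset Node) : ℕ := ∑ z ∈ Z, D z

/-- A distribution `D` is `K`-sparse if `D(Z) ≤ |Z| + K·|F|` for every finite zone
`Z` of `T` with frontier `F`. -/
def Sparse (T : Set Node) (K : ℕ) (D : Node → ℕ) : Prop :=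
  ∀ Z : Finset Node, IsZone T ↑Z →
    ZoneSum D Z ≤ Z.card + K * (zoneFrontier T ↑Z).ncard

/-- A distribution `D` is strongly `K`-sparse if `D(Z) ≤ K·|F|` for every finite zone
`Z` of `T` with frontier `F`. -/
def StronglySparse (T : Set Node) (K : ℕ) (D : Node → ℕ) : Prop :=
  ∀ Z : Finset Node, IsZone T ↑Z →
    ZoneSum D Z ≤ K * (zoneFrontier T ↑Z).ncard

/-- A flow `f` is compatible with a distribution `D` on `T` if
`D(x) + f(x) ≤ 1 + f(x0) + f(x1)` for every inner node `x` of `T` and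
`D(x) + f(x) ≤ 1` for every leaf `x` of `T`. -/
def FlowCompatible (T : Set Node) (D : Node → ℕ) (f : Node → ℤ) : Prop :=
  ∀ x ∈ T,
    (x ++ [false] ∈ T → (D x : ℤ) + f x ≤ 1 + f (x ++ [false]) + f (x ++ [true])) ∧
    (x ++ [false] ∉ T → (D x : ℤ) + f x ≤ 1)

/-- A flow `f` is bounded by `C` on `T` if `|f(x)| ≤ C` for all `x ∈ T`. -/
def FlowBounded (T : Set Node) (C : ℕ) (f : Node → ℤ) : Prop :=
  ∀ x ∈ T, |f x| ≤ (C : ℤ)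

/-- The largest flow on the truncation of `T` at relative depth `n` that is compatible with `D`
and bounded above by `C`. -/
noncomputable def greedyFlow (T : Set Node) (D : Node → ℕ) (C : ℤ) : ℕ → Node → ℤ
  | 0, _ => C
  | n + 1, x =>
    open Classical in
    min C (1 - (D x : ℤ) + if x ++ [false] ∈ T then
      greedyFlow T D C n (x ++ [false]) + greedyFlow T D C n (x ++ [true]) else 0)

theorem greedyFlow_le (T : Set Node) (D : Node → ℕ) (C : ℤ) (n : ℕ) (x : Node) :
    greedyFlow T D C n x ≤ C := by
  cases n with
  | zero => exact le_rfl
  | succ n => exact min_le_left _ _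

theorem greedyFlow_succ_le (T : Set Node) (D : Node → ℕ) (C : ℤ) (n : ℕ) :
    ∀ x, greedyFlow T D C (n + 1) x ≤ greedyFlow T D C n x := by
  induction n with
  | zero => exact fun x => greedyFlow_le T D C 1 x
  | succ n ih =>
    intro x
    have h₀ := ih (x ++ [false])
    have h₁ := ih (x ++ [true])
    conv_lhs => rw [greedyFlow]
    conv_rhs => rw [greedyFlow]
    split_ifs
    · exact min_le_min le_rfl (by linarith)
    · exact le_rfl

theorem greedyFlow_antitone (T : Set Node) (D : Node → ℕ) (C : ℤ) (x : Node) :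
    Antitone fun n => greedyFlow T D C n x :=
  antitone_nat_of_succ_le fun n => greedyFlow_succ_le T D C n x

theorem prefix_iff_eq_or_child_prefix {x y : Node} :
    x <+: y ↔ y = x ∨ x ++ [false] <+: y ∨ x ++ [true] <+: y := by
  constructor
  · rintro ⟨t, rfl⟩
    rcases t with _ | ⟨b, t⟩
    · simp
    · cases b <;> simp [List.prefix_append_right_inj, List.cons_prefix_cons]
  · rintro (rfl | h | h)
    · exact List.prefix_rfl
    · exact (List.prefix_append _ _).trans h
    · exact (List.prefix_append _ _).trans h

theorem not_child_prefix_self (x : Node) (b : Bool) : ¬ x ++ [b] <+: x := fun h => by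
  have := h.length_le
  simp at this

theorem not_both_children_prefix {x y : Node} (h₀ : x ++ [false] <+: y) (h₁ : x ++ [true] <+: y) :
    False := by
  have := List.prefix_of_prefix_length_le h₀ h₁ (by simp)
  simp [List.prefix_append_right_inj, List.cons_prefix_cons] at this

/-- `Z` is a set of descendants of `x` in `T` closed under prefixes that extend `x`, and `E` contains the nodes through
which branches from `x` leave `Z`. For `Z = ∅` the only such exit is `x` itself. -/
structure IsCut (T : Set Node) (x : Node) (Z E : Finset Node) : Prop where
  subset : ∀ z ∈ Z, z ∈ T
  le : ∀ z ∈ Z, x <+: z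
  convex : ∀ y, ∀ z ∈ Z, x <+: y → y <+: z → y ∈ Z
  exit : ∀ y ∈ T, x <+: y → y ∉ Z → (y = x ∨ y.dropLast ∈ Z) → y ∈ E

namespace IsCut

variable {T : Set Node} {x : Node} {Z E : Finset Node}

theorem empty (T : Set Node) (x : Node) : IsCut T x ∅ {x} where
  subset := by simp
  le := by simp
  convex := by simp
  exit := by simp

theorem leaf (hT : IsTreeDomain T) (hx : x ∈ T) (h : x ++ [false] ∉ T) : IsCut T x {x} ∅ where
  subset := by simpa using hx
  le := by simp
  convex := by
    intro y z hz hy hyz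
    rw [Finset.mem_singleton] at hz ⊢
    subst hz
    exact hyz.eq_of_length_le hy.length_le
  exit := by
    intro y hy hxy hyx _
    rcases prefix_iff_eq_or_child_prefix.1 hxy with rfl | h' | h'
    · simp at hyx
    · exact absurd (hT.2.1 _ _ h' hy) h
    · exact absurd ((hT.2.2 x).2 (hT.2.1 _ _ h' hy)) h

theorem node (hx : x ∈ T) {Z₀ E₀ Z₁ E₁ : Finset Node}
    (h₀ : IsCut T (x ++ [false]) Z₀ E₀) (h₁ : IsCut T (x ++ [true]) Z₁ E₁) :
    IsCut T x (insert x (Z₀ ∪ Z₁)) (E₀ ∪ E₁) where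
  subset := by
    intro z hz
    simp only [Finset.mem_insert, Finset.mem_union] at hz
    rcases hz with rfl | hz | hz
    exacts [hx, h₀.subset z hz, h₁.subset z hz]
  le := by
    intro z hz
    simp only [Finset.mem_insert, Finset.mem_union] at hz
    rcases hz with rfl | hz | hz
    exacts [List.prefix_rfl, (List.prefix_append _ _).trans (h₀.le z hz),
      (List.prefix_append _ _).trans (h₁.le z hz)]
  convex := by
    intro y z hz hy hyz
    simp only [Finset.mem_insert, Finset.mem_union] at hz ⊢
    rcases prefix_iff_eq_or_child_prefix.1 hy with rfl | h | h
    · exact Or.inl rfl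
    · rcases hz with rfl | hz | hz
      · exact absurd (h.trans hyz) (not_child_prefix_self _ _)
      · exact Or.inr (Or.inl (h₀.convex y z hz h hyz))
      · exact (not_both_children_prefix (h.trans hyz) (h₁.le z hz)).elim
    · rcases hz with rfl | hz | hz
      · exact absurd (h.trans hyz) (not_child_prefix_self _ _)
      · exact (not_both_children_prefix (h₀.le z hz) (h.trans hyz)).elim
      · exact Or.inr (Or.inr (h₁.convex y z hz h hyz))
  exit := by
    intro y hy hxy hyZ hyx
    simp only [Finset.mem_insert, Finset.mem_union, not_or] at hyZ hyx ⊢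
    obtain ⟨hne, hy0, hy1⟩ := hyZ
    have key : y.dropLast = x → ∀ b, x ++ [b] <+: y → y = x ++ [b] := by
      rintro h b ⟨t, rfl⟩
      have := congrArg List.length h
      rw [List.length_dropLast, List.length_append, List.length_append,
        List.length_singleton] at this
      have ht : t = [] := List.length_eq_zero_iff.1 (by omega)
      simp [ht]
    rcases prefix_iff_eq_or_child_prefix.1 hxy with rfl | h | h
    · exact absurd rfl hne
    · refine Or.inl (h₀.exit y hy h hy0 ?_)
      rcases hyx with h' | h' | h' | h'
      · exact absurd h' hne
      · exact Or.inl (key h' _ h)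
      · exact Or.inr h'
      · exact (not_both_children_prefix h ((h₁.le _ h').trans (List.dropLast_prefix y))).elim
    · refine Or.inr (h₁.exit y hy h hy1 ?_)
      rcases hyx with h' | h' | h' | h'
      · exact absurd h' hne
      · exact Or.inl (key h' _ h)
      · exact (not_both_children_prefix ((h₀.le _ h').trans (List.dropLast_prefix y)) h).elim
      · exact Or.inr h'

theorem root_mem (h : IsCut T x Z E) (hZ : Z.Nonempty) : x ∈ Z := by
  obtain ⟨z, hz⟩ := hZ
  exact h.convex x z hz List.prefix_rfl (h.le z hz)

theorem zoneLeast (h : IsCut T x Z E) (hZ : Z.Nonempty) : ZoneLeast (Z : Set Node) x :=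
  ⟨Finset.mem_coe.2 (h.root_mem hZ), h.le⟩

theorem isZone (h : IsCut T x Z E) (hZ : Z.Nonempty) : IsZone T (Z : Set Node) :=
  ⟨h.subset, ⟨x, h.zoneLeast hZ⟩,
    fun a y z ha hz hay hyz => h.convex y z hz ((h.le a ha).trans hay) hyz⟩

theorem zoneFrontier_subset (h : IsCut T x Z E) (hZ : Z.Nonempty) :
    zoneFrontier T (Z : Set Node) ⊆ ↑(insert x E) := by
  rintro y (hy | ⟨hyT, hyZ, -, hyd⟩)
  · have : y = x := (hy.2 x (h.root_mem hZ)).eq_of_length_le (h.le y hy.1).length_le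
    simp [this]
  · exact Finset.mem_coe.2 (Finset.mem_insert_of_mem (h.exit y hyT
      ((h.le _ hyd).trans (List.dropLast_prefix y)) hyZ (Or.inr hyd)))

theorem le_sum {D : Node → ℕ} {K : ℕ} (hD : Sparse T K D) (h : IsCut T x Z E) (hZ : Z.Nonempty) :
    -(K : ℤ) * (E.card + 1) ≤ ∑ z ∈ Z, (1 - (D z : ℤ)) := by
  have hcard : (zoneFrontier T (Z : Set Node)).ncard ≤ E.card + 1 :=
    (Set.ncard_le_ncard (h.zoneFrontier_subset hZ) (Finset.finite_toSet _)).trans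
      (by rw [Set.ncard_coe_finset]; exact Finset.card_insert_le _ _)
  have hsum : ∑ z ∈ Z, D z ≤ Z.card + K * (E.card + 1) :=
    (hD Z (h.isZone hZ)).trans (by gcongr)
  zify at hsum
  simp only [Finset.sum_sub_distrib, Finset.sum_const, nsmul_eq_mul, mul_one]
  linarith

theorem finite_of_exit_empty (hT : IsTreeDomain T) (h : IsCut T x Z ∅) (hZ : Z.Nonempty) :
    {y ∈ T | x <+: y}.Finite := by
  refine Z.finite_toSet.subset ?_
  rintro _ ⟨hy, t, rfl⟩
  induction t using List.reverseRecOn with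
  | nil => simpa using h.root_mem hZ
  | append_singleton t b ih =>
    rw [← List.append_assoc] at hy ⊢
    by_contra hyZ
    have := h.exit _ hy ((List.prefix_append _ _).trans (List.prefix_append _ _)) hyZ
      (Or.inr (by simpa using ih (hT.2.1 _ _ (List.prefix_append _ _) hy)))
    simp at this

end IsCut

theorem exists_isCut_le_greedyFlow {T : Set Node} (hT : IsTreeDomain T) (D : Node → ℕ) {C : ℤ}
    (hC : 0 ≤ C) (n : ℕ) : ∀ x ∈ T, ∃ Z E : Finset Node, IsCut T x Z E ∧
      ∑ z ∈ Z, (1 - (D z : ℤ)) + C * E.card ≤ greedyFlow T D C n x := by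
  induction n with
  | zero => exact fun x _ => ⟨∅, {x}, IsCut.empty T x, by simp [greedyFlow]⟩
  | succ n ih =>
    intro x hx
    rw [greedyFlow]
    rcases min_choice C (1 - (D x : ℤ) + open Classical in if x ++ [false] ∈ T then
      greedyFlow T D C n (x ++ [false]) + greedyFlow T D C n (x ++ [true]) else 0) with h | h
    · rw [h]
      exact ⟨∅, {x}, IsCut.empty T x, by simp⟩
    rw [h]
    by_cases hx0 : x ++ [false] ∈ T
    · obtain ⟨Z₀, E₀, h₀, hs₀⟩ := ih _ hx0
      obtain ⟨Z₁, E₁, h₁, hs₁⟩ := ih _ ((hT.2.2 x).1 hx0)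
      refine ⟨_, _, h₀.node hx h₁, ?_⟩
      have hdisj : Disjoint Z₀ Z₁ := Finset.disjoint_left.2 fun z hz₀ hz₁ =>
        not_both_children_prefix (h₀.le z hz₀) (h₁.le z hz₁)
      have hxZ : x ∉ Z₀ ∪ Z₁ := by
        rw [Finset.mem_union]
        rintro (hz | hz)
        · exact not_child_prefix_self _ _ (h₀.le x hz)
        · exact not_child_prefix_self _ _ (h₁.le x hz)
      rw [Finset.sum_insert hxZ, Finset.sum_union hdisj, if_pos hx0]
      have hE : ((E₀ ∪ E₁).card : ℤ) ≤ E₀.card + E₁.card :=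
        mod_cast Finset.card_union_le E₀ E₁
      nlinarith [mul_le_mul_of_nonneg_left hE hC]
    · exact ⟨_, _, IsCut.leaf hT hx hx0, by simp [hx0]⟩

theorem neg_le_greedyFlow {T : Set Node} (hT : IsTreeDomain T) {K : ℕ} {D : Node → ℕ}
    (hD : Sparse T K D) {C : ℤ} (hC : 2 * (K : ℤ) ≤ C) (n : ℕ) {x : Node} (hx : x ∈ T) :
    -(K : ℤ) ≤ greedyFlow T D C n x := by
  obtain ⟨Z, E, h, hle⟩ := exists_isCut_le_greedyFlow hT D (by linarith) n x hx
  have hE := mul_le_mul_of_nonneg_right hC (Nat.cast_nonneg (α := ℤ) E.card)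
  have hKE : 0 ≤ (K : ℤ) * E.card := by positivity
  rcases Z.eq_empty_or_nonempty with rfl | hZ
  · rw [Finset.sum_empty] at hle
    linarith
  · linarith [h.le_sum hD hZ]

theorem greedyFlow_nonneg {T : Set Node} (hT : IsTreeDomain T) {K : ℕ} {D : Node → ℕ}
    (hD : Sparse T K D) {C : ℤ} (hC : 2 * (K : ℤ) ≤ C) (n : ℕ) {x : Node} (hx : x ∈ T)
    (hinf : {y ∈ T | x <+: y}.Infinite) : 0 ≤ greedyFlow T D C n x := by
  obtain ⟨Z, E, h, hle⟩ := exists_isCut_le_greedyFlow hT D (by linarith) n x hx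
  have hE := mul_le_mul_of_nonneg_right hC (Nat.cast_nonneg (α := ℤ) E.card)
  rcases Z.eq_empty_or_nonempty with rfl | hZ
  · rw [Finset.sum_empty] at hle
    have hKE : 0 ≤ (K : ℤ) * E.card := by positivity
    linarith
  · have hEpos : (1 : ℤ) ≤ E.card := by
      rcases E.eq_empty_or_nonempty with rfl | hE'
      · exact absurd (h.finite_of_exit_empty hT hZ) hinf
      · exact_mod_cast hE'.card_pos
    have := mul_le_mul_of_nonneg_left hEpos (Nat.cast_nonneg (α := ℤ) K)
    linarith [h.le_sum hD hZ]

theorem exists_eventually_greedyFlow_eq {T : Set Node} {D : Node → ℕ} {B C : ℤ} {x : Node}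
    (hB : ∀ n, B ≤ greedyFlow T D C n x) :
    ∃ a : ℤ, ∀ᶠ n in Filter.atTop, greedyFlow T D C n x = a := by
  obtain ⟨a, ⟨N, hN⟩, ha⟩ := Int.exists_least_of_bdd (P := fun z => ∃ n, greedyFlow T D C n x = z)
    ⟨B, fun z ⟨n, hn⟩ => hn ▸ hB n⟩ ⟨_, 0, rfl⟩
  refine ⟨a, Filter.eventually_atTop.2 ⟨N, fun n hn => ?_⟩⟩
  exact le_antisymm (hN ▸ greedyFlow_antitone T D C x hn) (ha _ ⟨n, rfl⟩)

/-- existence part of the paper's Lemma `flow-infinite`: for every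
infinite binary tree domain `T`, every `K ≥ 1` and every `K`-sparse distribution
`D` on `T`, there is a flow `f` compatible with `D`, bounded by `7K`, with
`f(ε) = 0`, and nonnegative on every node lying on an infinite branch of `T`. -/
theorem flow_infinite (T : Set Node) (hT : IsTreeDomain T) (hinf : T.Infinite)
    (K : ℕ) (hK : 1 ≤ K) (D : Node → ℕ) (hD : Sparse T K D) :
    ∃ f : Node → ℤ, FlowCompatible T D f ∧ FlowBounded T (7 * K) f ∧
      f [] = 0 ∧
      ∀ x ∈ T, {y ∈ T | x <+: y}.Infinite → 0 ≤ f x := by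
  have hC : 2 * (K : ℤ) ≤ 7 * K := by linarith [Nat.cast_nonneg (α := ℤ) K]
  have hlim : ∀ x, ∃ a : ℤ, x ∈ T →
      ∀ᶠ n in Filter.atTop, greedyFlow T D (7 * K) n x = a := by
    intro x
    by_cases hx : x ∈ T
    · obtain ⟨a, ha⟩ := exists_eventually_greedyFlow_eq fun n => neg_le_greedyFlow hT hD hC n hx
      exact ⟨a, fun _ => ha⟩
    · exact ⟨0, fun h => absurd h hx⟩
  choose g hg using hlim
  have hroot : [] ∈ T := by
    obtain ⟨x, hx⟩ := hT.1
    exact hT.2.1 _ _ List.nil_prefix hx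
  have hnonneg : ∀ x ∈ T, {y ∈ T | x <+: y}.Infinite → 0 ≤ g x := by
    intro x hx hxinf
    obtain ⟨n, hn⟩ := (hg x hx).exists
    exact hn ▸ greedyFlow_nonneg hT hD hC n hx hxinf
  have hg0 : 0 ≤ g [] := hnonneg [] hroot (by simpa using hinf)
  have hstep : ∀ x ∈ T, g x ≤ 1 - (D x : ℤ) + open Classical in if x ++ [false] ∈ T then
      g (x ++ [false]) + g (x ++ [true]) else 0 := by
    intro x hx
    have hx' := (Filter.tendsto_add_atTop_nat 1).eventually (hg x hx)
    by_cases hx0 : x ++ [false] ∈ T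
    · obtain ⟨n, hn, hn0, hn1⟩ :=
        (hx'.and ((hg _ hx0).and (hg _ ((hT.2.2 x).1 hx0)))).exists
      rw [← hn, greedyFlow, ← hn0, ← hn1]
      exact min_le_right _ _
    · obtain ⟨n, hn⟩ := hx'.exists
      rw [← hn, greedyFlow, if_neg hx0, if_neg hx0]
      exact min_le_right _ _
  have hle : ∀ x, (if x = [] then 0 else g x) ≤ g x := by
    intro x
    split_ifs with h
    · exact h ▸ hg0
    · exact le_rfl
  refine ⟨fun x => if x = [] then 0 else g x, fun x hx => ⟨fun hx0 => ?_, fun hx0 => ?_⟩,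
    fun x hx => ?_, if_pos rfl, fun x hx hxinf => ?_⟩
  · have := hstep x hx
    rw [if_pos hx0] at this
    simp only [List.append_eq_nil_iff, List.cons_ne_nil, and_false, if_false]
    linarith [hle x]
  · have := hstep x hx
    rw [if_neg hx0] at this
    linarith [hle x]
  · dsimp only
    split_ifs
    · simp
    · obtain ⟨n, hn⟩ := (hg x hx).exists
      rw [← hn, abs_le]
      push_cast
      exact ⟨by linarith [neg_le_greedyFlow hT hD hC n hx], greedyFlow_le _ _ _ _ _⟩
  · dsimp only
    split_ifs
    · exact le_rfl
    · exact hnonneg x hx hxinf
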